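/- Fix an integer ℓ ≥ 2 and set λ₀ = √(ℓ(ℓ+1)), λ₁ = √((ℓ−1)(ℓ+2)). Let α₀,…,α₄ : (−1,1) → ℝ be C¹ functions satisfying the α-evolution system on (−1,1) and the α-constraints at τ = 0, and suppose α₀(0) = α₄(0). Then each α_n is the restriction to (−1,1) of a polynomial in τ of degree at most 2ℓ; in particular each α_n extends analytically through the critical points τ = ±1. -/

import Mathlib

/-- The α-evolution system on `(−1,1)` for the spin-2 coefficient functions. -/
noncomputable def AlphaEvol (ℓ : ℕ) (lam0 lam1 : ℝ) (α : Fin 5 → ℝ → ℝ) : Prop :=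
  ∀ τ ∈ Set.Ioo (-1 : ℝ) 1,
    ((1 - τ) * deriv (α 0) τ = lam1 * α 1 τ + (2 - (ℓ : ℝ)) * α 0 τ) ∧
    (deriv (α 1) τ = α 1 τ - lam1 / 2 * α 0 τ + lam0 / 2 * α 2 τ) ∧
    (deriv (α 2) τ = -(lam0 / 2) * α 1 τ + lam0 / 2 * α 3 τ) ∧
    (deriv (α 3) τ = -α 3 τ - lam0 / 2 * α 2 τ + lam1 / 2 * α 4 τ) ∧
    ((1 + τ) * deriv (α 4) τ = -lam1 * α 3 τ - (2 - (ℓ : ℝ)) * α 4 τ)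

/-- The α-constraints at `τ = 0`. -/
def AlphaConstr0 (ℓ : ℕ) (lam0 lam1 : ℝ) (α : Fin 5 → ℝ → ℝ) : Prop :=
  (-(ℓ : ℝ) * α 1 0 + 1 / 2 * (lam1 * α 0 0 + lam0 * α 2 0) = 0) ∧
  (-(ℓ : ℝ) * α 2 0 + lam0 / 2 * (α 1 0 + α 3 0) = 0) ∧
  (-(ℓ : ℝ) * α 3 0 + 1 / 2 * (lam1 * α 4 0 + lam0 * α 2 0) = 0)

/-- Two solutions of a linear ODE with continuous coefficients on an open interval agree
everywhere if they agree at one point. -/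
theorem linear_ode_eqOn_Ioo {E : Type*} [NormedAddCommGroup E] [NormedSpace ℝ E]
    {A : ℝ → E →L[ℝ] E} {a b t₀ : ℝ} (ht₀ : t₀ ∈ Set.Ioo a b)
    (hA : ContinuousOn A (Set.Ioo a b)) {f g : ℝ → E}
    (hf : ∀ t ∈ Set.Ioo a b, HasDerivAt f (A t (f t)) t)
    (hg : ∀ t ∈ Set.Ioo a b, HasDerivAt g (A t (g t)) t)
    (h₀ : f t₀ = g t₀) : Set.EqOn f g (Set.Ioo a b) := by
  intro t ht
  obtain ⟨a', ha, ha'⟩ := exists_between (lt_min ht.1 ht₀.1)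
  obtain ⟨b', hb', hb⟩ := exists_between (max_lt ht.2 ht₀.2)
  rw [lt_min_iff] at ha'
  rw [max_lt_iff] at hb'
  have hsub : Set.Icc a' b' ⊆ Set.Ioo a b := Set.Icc_subset_Ioo ha hb
  obtain ⟨C, hC⟩ := isCompact_Icc.exists_bound_of_continuousOn (hA.mono hsub)
  refine ODE_solution_unique_of_mem_Ioo (v := fun t x => A t x) (s := fun _ => Set.univ)
    (K := C.toNNReal) (fun s hs => ?_) (t₀ := t₀) ⟨ha'.2, hb'.2⟩
    (fun s hs => ⟨hf s (hsub (Set.Ioo_subset_Icc_self hs)), Set.mem_univ _⟩)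
    (fun s hs => ⟨hg s (hsub (Set.Ioo_subset_Icc_self hs)), Set.mem_univ _⟩) h₀
    (⟨ha'.1, hb'.1⟩ : t ∈ Set.Ioo a' b')
  refine ((A s).lipschitz.weaken ?_).lipschitzOnWith
  rw [← NNReal.coe_le_coe, coe_nnnorm]
  exact (hC s (Set.Ioo_subset_Icc_self hs)).trans (Real.le_coe_toNNReal C)

/-- The coefficient matrix of the α-evolution system solved for the derivatives. -/
noncomputable def alphaMatrix (ℓ : ℕ) (lam0 lam1 t : ℝ) : Matrix (Fin 5) (Fin 5) ℝ :=
  !![(2 - (ℓ : ℝ)) * (1 - t)⁻¹, lam1 * (1 - t)⁻¹, 0, 0, 0;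
    -(lam1 / 2), 1, lam0 / 2, 0, 0;
    0, -(lam0 / 2), 0, lam0 / 2, 0;
    0, 0, -(lam0 / 2), -1, lam1 / 2;
    0, 0, 0, -lam1 * (1 + t)⁻¹, -(2 - (ℓ : ℝ)) * (1 + t)⁻¹]

theorem continuousOn_alphaMatrix (ℓ : ℕ) (lam0 lam1 : ℝ) :
    ContinuousOn (alphaMatrix ℓ lam0 lam1) (Set.Ioo (-1) 1) := by
  have h₁ : ContinuousOn (fun t : ℝ => (1 - t)⁻¹) (Set.Ioo (-1) 1) :=
    ContinuousOn.inv₀ (by fun_prop) fun t ht => (sub_pos.2 ht.2).ne'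
  have h₂ : ContinuousOn (fun t : ℝ => (1 + t)⁻¹) (Set.Ioo (-1) 1) :=
    ContinuousOn.inv₀ (by fun_prop) fun t ht => by linarith [ht.1]
  refine continuousOn_pi.2 fun i => continuousOn_pi.2 fun j => ?_
  fin_cases i <;> fin_cases j <;> simp [alphaMatrix] <;> fun_prop

/-- A differentiable solution of the α-evolution system solves the matrix ODE. -/
theorem AlphaEvol.hasDerivAt {ℓ : ℕ} {lam0 lam1 : ℝ} {α : Fin 5 → ℝ → ℝ}
    (hev : AlphaEvol ℓ lam0 lam1 α)
    (hd : ∀ n, ∀ t ∈ Set.Ioo (-1 : ℝ) 1, DifferentiableAt ℝ (α n) t)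
    {t : ℝ} (ht : t ∈ Set.Ioo (-1 : ℝ) 1) :
    HasDerivAt (fun s n => α n s) ((alphaMatrix ℓ lam0 lam1 t).mulVec fun n => α n t) t := by
  obtain ⟨e0, e1, e2, e3, e4⟩ := hev t ht
  have h₁ : 1 - t ≠ 0 := (sub_pos.2 ht.2).ne'
  have h₂ : 1 + t ≠ 0 := by linarith [ht.1]
  refine hasDerivAt_pi.2 fun n => ?_
  convert (hd n t ht).hasDerivAt using 1
  fin_cases n <;> simp [alphaMatrix, Matrix.mulVec, dotProduct, Fin.sum_univ_five]
  · field_simp; linarith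
  · linarith
  · linarith
  · linarith
  · field_simp; linarith

theorem AlphaEvol.eqOn {ℓ : ℕ} {lam0 lam1 : ℝ} {α β : Fin 5 → ℝ → ℝ}
    (hα : AlphaEvol ℓ lam0 lam1 α) (hβ : AlphaEvol ℓ lam0 lam1 β)
    (hdα : ∀ n, ∀ t ∈ Set.Ioo (-1 : ℝ) 1, DifferentiableAt ℝ (α n) t)
    (hdβ : ∀ n, ∀ t ∈ Set.Ioo (-1 : ℝ) 1, DifferentiableAt ℝ (β n) t)
    (h₀ : ∀ n, α n 0 = β n 0) (n : Fin 5) : Set.EqOn (α n) (β n) (Set.Ioo (-1) 1) := by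
  let L : Matrix (Fin 5) (Fin 5) ℝ →ₗ[ℝ] (Fin 5 → ℝ) →L[ℝ] (Fin 5 → ℝ) :=
    (LinearMap.toContinuousLinearMap.toLinearMap).comp (Matrix.toLin'.toLinearMap)
  have hL : Continuous L := L.continuous_of_finiteDimensional
  have h := linear_ode_eqOn_Ioo (A := fun t => L (alphaMatrix ℓ lam0 lam1 t)) (t₀ := 0)
    (by norm_num) (hL.comp_continuousOn (continuousOn_alphaMatrix ℓ lam0 lam1))
    (f := fun s n => α n s) (g := fun s n => β n s)
    (fun t ht => hα.hasDerivAt hdα ht) (fun t ht => hβ.hasDerivAt hdβ ht) (funext h₀)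
  exact fun t ht => congrFun (h ht) n

/-- The polynomial `c (1 - X) ^ i (1 + X) ^ j`. -/
noncomputable def jacobiWeight (c : ℝ) (i j : ℕ) : Polynomial ℝ :=
  Polynomial.C c * (1 - Polynomial.X) ^ i * (1 + Polynomial.X) ^ j

theorem natDegree_jacobiWeight_le (c : ℝ) (i j : ℕ) :
    (jacobiWeight c i j).natDegree ≤ i + j := by
  unfold jacobiWeight
  compute_degree

theorem eval_jacobiWeight (c : ℝ) (i j : ℕ) (t : ℝ) :
    (jacobiWeight c i j).eval t = c * (1 - t) ^ i * (1 + t) ^ j := by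
  simp [jacobiWeight]

theorem deriv_jacobiWeight (c : ℝ) (i j : ℕ) (t : ℝ) :
    deriv (fun s => (jacobiWeight c i j).eval s) t =
      c * (-(i * (1 - t) ^ (i - 1)) * (1 + t) ^ j + (1 - t) ^ i * (j * (1 + t) ^ (j - 1))) := by
  rw [Polynomial.deriv]
  simp [jacobiWeight, Polynomial.derivative_pow]
  ring

/-- The regular solution of the α-evolution system, for `ℓ = k + 2`. -/
noncomputable def alphaPoly (k : ℕ) (c : Fin 5 → ℝ) (n : Fin 5) : Polynomial ℝ :=
  jacobiWeight (c n) (k + n) (k + 4 - n)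

theorem natDegree_alphaPoly_le (k : ℕ) (c : Fin 5 → ℝ) (n : Fin 5) :
    (alphaPoly k c n).natDegree ≤ 2 * (k + 2) :=
  (natDegree_jacobiWeight_le _ _ _).trans (by lia)

theorem alphaEvol_alphaPoly {k : ℕ} {lam0 lam1 : ℝ} {c : Fin 5 → ℝ}
    (h0 : lam1 * c 0 = (k + 1) * c 1) (h1 : lam1 * c 1 = (k + 4) * c 0)
    (h2 : lam0 * c 1 = (k + 2) * c 2) (h3 : lam0 * c 2 = (k + 3) * c 1)
    (h4 : c 3 = c 1) (h5 : c 4 = c 0) :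
    AlphaEvol (k + 2) lam0 lam1 fun n t => (alphaPoly k c n).eval t := by
  intro t _
  have p (x : ℝ) : k * x ^ (k - 1) * x = k * x ^ k := by
    cases k <;> simp [pow_succ, mul_assoc]
  simp only [alphaPoly, deriv_jacobiWeight]
  simp [eval_jacobiWeight, h4, h5, pow_succ]
  refine ⟨?_, ?_, ?_, ?_, ?_⟩
  · linear_combination (-c 0 * (1 + t) ^ k * (1 + t) ^ 4) * p (1 - t)
      - ((1 - t) ^ k * (1 - t) * (1 + t) ^ k * (1 + t) ^ 3) * h1
  · linear_combination ((1 - t) ^ k * (1 + t) ^ k * (1 + t) ^ 4 / 2) * h0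
      - ((1 - t) ^ k * (1 - t) ^ 2 * (1 + t) ^ k * (1 + t) ^ 2 / 2) * h3
  · linear_combination ((1 - t) ^ k * (1 - t) * (1 + t) ^ k * (1 + t) ^ 3 / 2
      - (1 - t) ^ k * (1 - t) ^ 3 * (1 + t) ^ k * (1 + t) / 2) * h2
  · linear_combination ((1 - t) ^ k * (1 - t) ^ 2 * (1 + t) ^ k * (1 + t) ^ 2 / 2) * h3
      - ((1 - t) ^ k * (1 - t) ^ 4 * (1 + t) ^ k / 2) * h0
  · linear_combination (c 0 * (1 - t) ^ k * (1 - t) ^ 4) * p (1 + t)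
      + ((1 - t) ^ k * (1 - t) ^ 3 * (1 + t) ^ k * (1 + t)) * h1

/-- a C¹ constrained solution of the α-evolution system with
`α₀(0) = α₄(0)` is, on `(−1,1)`, the restriction of polynomials of degree at most `2ℓ`. -/
theorem alpha_polynomial_of_regular_data (ℓ : ℕ) (hℓ : 2 ≤ ℓ) (lam0 lam1 : ℝ)
    (hlam0 : lam0 = Real.sqrt ((ℓ : ℝ) * ((ℓ : ℝ) + 1)))
    (hlam1 : lam1 = Real.sqrt (((ℓ : ℝ) - 1) * ((ℓ : ℝ) + 2)))
    (α : Fin 5 → ℝ → ℝ)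
    (hreg : ∀ n, ContDiffOn ℝ 1 (α n) (Set.Ioo (-1 : ℝ) 1))
    (hev : AlphaEvol ℓ lam0 lam1 α)
    (hcon : AlphaConstr0 ℓ lam0 lam1 α)
    (hdata : α 0 0 = α 4 0) :
    ∀ n, ∃ p : Polynomial ℝ, p.natDegree ≤ 2 * ℓ ∧
      ∀ τ ∈ Set.Ioo (-1 : ℝ) 1, α n τ = p.eval τ := by
  obtain ⟨k, rfl⟩ := Nat.exists_eq_add_of_le' hℓ
  obtain ⟨c0, c1, c2⟩ := hcon
  have hk : (0 : ℝ) ≤ k := k.cast_nonneg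
  push_cast at *
  have s0 : lam0 * lam0 = (k + 2) * (k + 3) := by
    rw [hlam0, Real.mul_self_sqrt (by positivity)]; ring
  have s1 : lam1 * lam1 = (k + 1) * (k + 4) := by
    rw [hlam1, Real.mul_self_sqrt (mul_nonneg (by linarith) (by linarith))]; ring
  have hne0 : lam0 ≠ 0 := by rintro rfl; nlinarith
  have hne1 : lam1 ≠ 0 := by rintro rfl; nlinarith
  have d3 : α 3 0 = α 1 0 := by
    have : ((k : ℝ) + 2) * (α 3 0 - α 1 0) = 0 := by rw [hdata] at c0; linarith
    rcases mul_eq_zero.1 this with h | h <;> linarith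
  rw [d3] at c1
  have h2 : lam0 * α 1 0 = (k + 2) * α 2 0 := by linarith
  have h3 : lam0 * α 2 0 = (k + 3) * α 1 0 := by
    refine mul_left_cancel₀ (show (k : ℝ) + 2 ≠ 0 by positivity) ?_
    linear_combination (-lam0) * h2 + α 1 0 * s0
  have h0 : lam1 * α 0 0 = (k + 1) * α 1 0 := by linarith
  have h1 : lam1 * α 1 0 = (k + 4) * α 0 0 := by
    refine mul_left_cancel₀ (show (k : ℝ) + 1 ≠ 0 by positivity) ?_
    linear_combination (-lam1) * h0 + α 0 0 * s1
  intro n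
  refine ⟨alphaPoly k (fun n => α n 0) n, natDegree_alphaPoly_le _ _ _, ?_⟩
  refine hev.eqOn (alphaEvol_alphaPoly h0 h1 h2 h3 d3 hdata.symm)
    (fun n t ht => ((hreg n).differentiableOn one_ne_zero).differentiableAt
      (isOpen_Ioo.mem_nhds ht))
    (fun n t _ => (alphaPoly k _ n).differentiableAt) (fun n => ?_) n
  simp [alphaPoly, eval_jacobiWeight]
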